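/- Let h be a nonzero real polynomial all of whose complex zeros lie in [-1,0], and let f be real-rooted. Then f ◇ h is real-rooted (or zero). Moreover, if g and f are real-rooted with g ⪯ f, then g ◇ h ⪯ f ◇ h. -/

import Mathlib

open Polynomial

/-- A real polynomial is real-rooted if it is nonzero and all of its complex zeros are real. -/
def RealRooted (f : Polynomial ℝ) : Prop :=
  f ≠ 0 ∧ ∀ z : ℂ, (f.map (algebraMap ℝ ℂ)).IsRoot z → z.im = 0

/-- The zeros of `f`, listed in increasing order (with multiplicity). -/
noncomputable def sortedRoots (f : Polynomial ℝ) : List ℝ :=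
  f.roots.sort (· ≤ ·)

/-- `g ⪯ f`: interlacing. Both are real-rooted, `deg f = deg g + 1`, and listing the zeros of
`f` as `α₁ ≤ ⋯ ≤ α_d` and of `g` as `β₁ ≤ ⋯ ≤ β_{d-1}` (with multiplicity, in increasing
order), one has `α₁ ≤ β₁ ≤ α₂ ≤ ⋯ ≤ β_{d-1} ≤ α_d`. -/
def Interlaces (g f : Polynomial ℝ) : Prop :=
  RealRooted f ∧ RealRooted g ∧ f.natDegree = g.natDegree + 1 ∧
  ∀ i, i < g.natDegree →
    (sortedRoots f).getD i 0 ≤ (sortedRoots g).getD i 0 ∧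
    (sortedRoots g).getD i 0 ≤ (sortedRoots f).getD (i + 1) 0

/-- `g ≺ f`: strict interlacing, where all the inequalities above are strict. -/
def StrictInterlaces (g f : Polynomial ℝ) : Prop :=
  RealRooted f ∧ RealRooted g ∧ f.natDegree = g.natDegree + 1 ∧
  ∀ i, i < g.natDegree →
    (sortedRoots f).getD i 0 < (sortedRoots g).getD i 0 ∧
    (sortedRoots g).getD i 0 < (sortedRoots f).getD (i + 1) 0

/-- The diamond product `f ◇ g = Σₙ (f⁽ⁿ⁾/n!)(g⁽ⁿ⁾/n!) xⁿ(x+1)ⁿ`. -/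
noncomputable def diamond (f g : Polynomial ℝ) : Polynomial ℝ :=
  ∑ n ∈ Finset.range (f.natDegree + 1),
    C (((n.factorial : ℝ) * n.factorial)⁻¹) *
      (derivative^[n] f) * (derivative^[n] g) * (X * (X + 1)) ^ n

/-- A complex polynomial is upper stable if it has no zeros in the open upper half-plane. -/
def UpperStable (p : Polynomial ℂ) : Prop :=
  ∀ z : ℂ, 0 < z.im → p.eval z ≠ 0

theorem UpperStable.ne_zero {p : Polynomial ℂ} (hp : UpperStable p) : p ≠ 0 := by
  rintro rfl
  exact hp Complex.I (by simp) (by simp)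

theorem UpperStable.mul {p q : Polynomial ℂ} (hp : UpperStable p) (hq : UpperStable q) :
    UpperStable (p * q) := fun z hz => by
  rw [eval_mul]
  exact mul_ne_zero (hp z hz) (hq z hz)

/-- Gauss–Lucas in the form: differentiation preserves upper stability. -/
theorem UpperStable.derivative {p : Polynomial ℂ} (hp : UpperStable p) (hd : 0 < p.natDegree) :
    UpperStable (derivative p) := by
  intro z hz h0
  have hd' : 0 < p.degree := natDegree_pos_iff_degree_pos.mp hd
  have hne : Polynomial.derivative p ≠ 0 := fun h =>
    hd.ne' (derivative_eq_zero.mp h)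
  have hmem : z ∈ (Polynomial.derivative p).rootSet ℂ := by
    rw [mem_rootSet, coe_aeval_eq_eval]
    exact ⟨hne, h0⟩
  have hsub : convexHull ℝ (p.rootSet ℂ) ⊆ {w : ℂ | w.im ≤ 0} := by
    refine convexHull_min (fun w hw => ?_) (convex_halfSpace_im_le 0)
    rw [mem_rootSet, coe_aeval_eq_eval] at hw
    exact not_lt.mp fun hlt => hp w hlt hw.2
  exact absurd (hsub (rootSet_derivative_subset_convexHull_rootSet hd' hmem)) (not_le.mpr hz)

theorem UpperStable.iterate_derivative {p : Polynomial ℂ} (hp : UpperStable p) {k : ℕ}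
    (hk : k ≤ p.natDegree) : UpperStable (Polynomial.derivative^[k] p) := by
  induction k generalizing p with
  | zero => exact hp
  | succ k ih =>
    rw [Function.iterate_succ_apply]
    refine ih (hp.derivative (Nat.zero_lt_of_lt hk)) ?_
    rw [natDegree_derivative]
    exact Nat.le_sub_one_of_lt hk

theorem UpperStable.hasseDeriv {p : Polynomial ℂ} (hp : UpperStable p) {k : ℕ}
    (hk : k ≤ p.natDegree) : UpperStable (Polynomial.hasseDeriv k p) := by
  intro z hz h0
  refine hp.iterate_derivative hk z hz ?_
  rw [← factorial_smul_hasseDeriv]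
  simp [h0]

theorem coeff_mul_reflect_comp {A B : Polynomial ℂ} (u : ℂ) (d : ℕ) :
    (A * reflect d (B.comp (C u * X))).coeff d =
      ∑ n ∈ Finset.range (d + 1), A.coeff n * B.coeff n * u ^ n := by
  rw [coeff_mul, Finset.Nat.sum_antidiagonal_eq_sum_range_succ_mk]
  refine Finset.sum_congr rfl fun n hn => ?_
  have hn' : n ≤ d := by simpa [Nat.lt_succ_iff] using hn
  rw [coeff_reflect, revAt_le (Nat.sub_le d n), Nat.sub_sub_self hn', comp_C_mul_X_coeff]
  ring

theorem eval_reflect_comp {B : Polynomial ℂ} {d : ℕ} (hd : B.natDegree ≤ d) (u : ℂ) {t : ℂ}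
    (ht : t ≠ 0) :
    (reflect d (B.comp (C u * X))).eval t = t ^ d * B.eval (u / t) := by
  have : Invertible t⁻¹ := invertibleOfNonzero (inv_ne_zero ht)
  have hdeg : (B.comp (C u * X)).natDegree ≤ d := by
    refine (natDegree_comp_le.trans ?_).trans hd
    exact (Nat.mul_le_mul_left _ ((natDegree_C_mul_le u X).trans natDegree_X_le)).trans
      (Nat.mul_one _).le
  have key := eval₂_reflect_mul_pow (RingHom.id ℂ) t⁻¹ d _ hdeg
  rw [invOf_eq_inv, inv_inv] at key
  change (reflect d (B.comp (C u * X))).eval t * t⁻¹ ^ d = (B.comp (C u * X)).eval t⁻¹ at key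
  rw [eval_comp, eval_mul, eval_C, eval_X, ← div_eq_mul_inv] at key
  rw [← key, inv_pow]
  field_simp

/-- The moving point `x - x(x+1)/(x+c)` stays in the closed lower half-plane. -/
theorem im_sub_div_nonpos {x : ℂ} (hx : 0 < x.im) {c : ℝ} (hc0 : 0 ≤ c) (hc1 : c ≤ 1) :
    (x - x * (x + 1) / (x + c)).im ≤ 0 := by
  have hne : x + c ≠ 0 := fun h => hx.ne' (by simpa using congrArg Complex.im h)
  have heq : x - x * (x + 1) / (x + c) = ((c - 1 : ℝ) : ℂ) * (x / (x + c)) := by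
    push_cast
    field_simp
    ring
  have him : (x / (x + c)).im = c * x.im / Complex.normSq (x + c) := by
    rw [Complex.div_im]
    simp
    ring
  rw [heq, Complex.im_ofReal_mul, him]
  exact mul_nonpos_of_nonpos_of_nonneg (by linarith)
    (div_nonneg (mul_nonneg hc0 hx.le) (Complex.normSq_nonneg _))

/-- The polynomial pairing behind the diamond product is nonvanishing on the upper half-plane. -/
theorem UpperStable.sum_taylor_coeff_ne_zero {p q : Polynomial ℂ} (hp : UpperStable p)
    (hq0 : q ≠ 0) (hq : ∀ z : ℂ, q.IsRoot z → z.im = 0 ∧ -1 ≤ z.re ∧ z.re ≤ 0)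
    {x : ℂ} (hx : 0 < x.im) :
    ∑ n ∈ Finset.range (q.natDegree + 1),
      (taylor x p).coeff n * (taylor x q).coeff n * (x * (x + 1)) ^ n ≠ 0 := by
  set d := q.natDegree
  set u := x * (x + 1)
  have hu : u ≠ 0 := mul_ne_zero (fun h => hx.ne' (by simp [h]))
    (fun h => hx.ne' (by simpa using congrArg Complex.im h))
  set R := reflect d ((taylor x q).comp (C u * X)) with hR
  have hdeg : (taylor x q).natDegree = d := natDegree_taylor q x
  have hRcoeff : R.coeff d ≠ 0 := by
    rw [hR, coeff_reflect, revAt_le le_rfl, Nat.sub_self, comp_C_mul_X_coeff, taylor_coeff_zero,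
      pow_zero, mul_one]
    exact fun h => hx.ne' (hq x h).1
  have hRstable : UpperStable (taylor (-x) R) := by
    intro y hy h0
    rw [taylor_eval] at h0
    by_cases ht : y + -x = 0
    · rw [ht, ← coeff_zero_eq_eval_zero, hR, coeff_reflect, revAt_le (Nat.zero_le d),
        Nat.sub_zero, comp_C_mul_X_coeff, ← hdeg, coeff_natDegree, leadingCoeff_taylor] at h0
      exact mul_ne_zero (leadingCoeff_ne_zero.mpr hq0) (pow_ne_zero _ hu) h0
    · rw [hR, eval_reflect_comp hdeg.le u ht, taylor_eval] at h0
      obtain ⟨him, hre1, hre0⟩ := hq _ ((mul_eq_zero.mp h0).resolve_left (pow_ne_zero _ ht))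
      set w := u / (y + -x) + x with hw
      have hwre : w = ((w.re : ℝ) : ℂ) := Complex.ext (by simp) (by simpa using him)
      have hne : x - w ≠ 0 := fun h => hx.ne' (by simpa [him] using congrArg Complex.im h)
      have hy' : y = x - u / (x + ((-w.re : ℝ) : ℂ)) := by
        rw [Complex.ofReal_neg, ← hwre, ← sub_eq_add_neg]
        have : (y + -x) * (w - x) = u := by
          rw [hw, add_sub_cancel_right]
          field_simp
        clear_value w u
        field_simp
        linear_combination -this
      have := im_sub_div_nonpos hx (c := -w.re) (by linarith) (by linarith)
      rw [← hy'] at this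
      linarith
  have hdR : d ≤ (p * taylor (-x) R).natDegree := by
    rw [natDegree_mul hp.ne_zero hRstable.ne_zero, natDegree_taylor]
    exact (le_natDegree_of_ne_zero hRcoeff).trans (Nat.le_add_left _ _)
  have key := (hp.mul hRstable).hasseDeriv hdR x hx
  rw [← taylor_coeff, taylor_mul, taylor_taylor, add_neg_cancel, taylor_zero, hR,
    coeff_mul_reflect_comp] at key
  exact key

theorem diamond_eq_sum_hasseDeriv (f h : Polynomial ℝ) :
    diamond f h = ∑ n ∈ Finset.range (f.natDegree + 1),
      hasseDeriv n f * hasseDeriv n h * (X * (X + 1)) ^ n := by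
  refine Finset.sum_congr rfl fun n _ => ?_
  have hn : (n.factorial : ℝ) ≠ 0 := by positivity
  have hder : ∀ p : Polynomial ℝ, derivative^[n] p = C (n.factorial : ℝ) * hasseDeriv n p := by
    intro p
    rw [← factorial_smul_hasseDeriv, LinearMap.smul_apply, nsmul_eq_mul, C_eq_natCast]
  have hC : C (((n.factorial : ℝ) * n.factorial)⁻¹) * (C (n.factorial : ℝ) * C (n.factorial : ℝ))
      = (1 : Polynomial ℝ) := by
    rw [← C_mul, ← C_mul, inv_mul_cancel₀ (mul_ne_zero hn hn), C_1]
  rw [hder, hder]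
  linear_combination (hasseDeriv n f * hasseDeriv n h * (X * (X + 1)) ^ n) * hC

theorem eval_map_diamond (f h : Polynomial ℝ) (x : ℂ) :
    ((diamond f h).map (algebraMap ℝ ℂ)).eval x =
      ∑ n ∈ Finset.range (h.natDegree + 1),
        (taylor x (f.map (algebraMap ℝ ℂ))).coeff n * (taylor x (h.map (algebraMap ℝ ℂ))).coeff n *
          (x * (x + 1)) ^ n := by
  have hmap : ∀ (n : ℕ) (p : Polynomial ℝ), ((hasseDeriv n p).map (algebraMap ℝ ℂ)).eval x =
      (taylor x (p.map (algebraMap ℝ ℂ))).coeff n := by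
    intro n p
    rw [taylor_coeff]
    congr 1
    ext i
    simp [hasseDeriv_coeff]
  have hzero : ∀ (p : Polynomial ℝ) (n : ℕ), n ∉ Finset.range (p.natDegree + 1) →
      (taylor x (p.map (algebraMap ℝ ℂ))).coeff n = 0 := by
    intro p n hn
    refine coeff_eq_zero_of_natDegree_lt ?_
    rw [natDegree_taylor, natDegree_map]
    simpa [Nat.lt_succ_iff] using hn
  rw [diamond_eq_sum_hasseDeriv, Polynomial.map_sum, eval_finsetSum]
  simp only [Polynomial.map_mul, Polynomial.map_pow, Polynomial.map_add, Polynomial.map_one, map_X,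
    eval_mul, eval_pow, eval_add, eval_one, eval_X, hmap]
  calc _ = ∑ n ∈ Finset.range (f.natDegree + 1) ∪ Finset.range (h.natDegree + 1),
          (taylor x (f.map (algebraMap ℝ ℂ))).coeff n *
            (taylor x (h.map (algebraMap ℝ ℂ))).coeff n * (x * (x + 1)) ^ n := by
        refine Finset.sum_subset Finset.subset_union_left fun n _ hn => ?_
        rw [hzero f n hn, zero_mul, zero_mul]
    _ = _ := by
        refine (Finset.sum_subset Finset.subset_union_right fun n _ hn => ?_).symm
        rw [hzero h n hn, mul_zero, zero_mul]

theorem natDegree_X_mul_X_add_one_pow_le (n : ℕ) :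
    ((X * (X + 1) : Polynomial ℝ) ^ n).natDegree ≤ 2 * n := by
  compute_degree
  omega

theorem coeff_X_mul_X_add_one_pow (n : ℕ) :
    ((X * (X + 1) : Polynomial ℝ) ^ n).coeff (2 * n) = 1 := by
  have hmonic : (X * (X + 1) : Polynomial ℝ).Monic := monic_X.mul (monic_X_add_C 1)
  have hdeg : (X * (X + 1) : Polynomial ℝ).natDegree = 2 := by compute_degree!
  have := (hmonic.pow n).coeff_natDegree
  rwa [hmonic.natDegree_pow, hdeg, mul_comm n] at this

theorem natDegree_diamond_le (f h : Polynomial ℝ) :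
    (diamond f h).natDegree ≤ f.natDegree + h.natDegree := by
  rw [diamond_eq_sum_hasseDeriv]
  refine natDegree_sum_le_of_forall_le _ _ fun n hn => ?_
  have hnf : n ≤ f.natDegree := by simpa [Nat.lt_succ_iff] using hn
  rcases lt_or_ge h.natDegree n with hnh | hnh
  · simp [hasseDeriv_eq_zero_of_lt_natDegree h n hnh]
  · refine natDegree_mul_le.trans ((add_le_add natDegree_mul_le le_rfl).trans ?_)
    have h1 := natDegree_hasseDeriv_le f n
    have h2 := natDegree_hasseDeriv_le h n
    have h3 := natDegree_X_mul_X_add_one_pow_le n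
    omega

theorem coeff_diamond (f h : Polynomial ℝ) :
    (diamond f h).coeff (f.natDegree + h.natDegree) = f.leadingCoeff * h.leadingCoeff *
      ∑ n ∈ Finset.range (f.natDegree + 1), (f.natDegree.choose n * h.natDegree.choose n : ℝ) := by
  rw [diamond_eq_sum_hasseDeriv, finsetSum_coeff, Finset.mul_sum]
  refine Finset.sum_congr rfl fun n hn => ?_
  have hnf : n ≤ f.natDegree := by simpa [Nat.lt_succ_iff] using hn
  rcases lt_or_ge h.natDegree n with hnh | hnh
  · simp [hasseDeriv_eq_zero_of_lt_natDegree h n hnh, Nat.choose_eq_zero_of_lt hnh]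
  · have hsum : f.natDegree + h.natDegree =
        ((f.natDegree - n) + (h.natDegree - n)) + 2 * n := by omega
    have h1 := natDegree_hasseDeriv_le f n
    have h2 := natDegree_hasseDeriv_le h n
    rw [hsum, coeff_mul_add_eq_of_natDegree_le (natDegree_mul_le.trans (add_le_add h1 h2))
      (natDegree_X_mul_X_add_one_pow_le n), coeff_mul_add_eq_of_natDegree_le h1 h2,
      coeff_X_mul_X_add_one_pow, hasseDeriv_coeff, hasseDeriv_coeff, Nat.sub_add_cancel hnf,
      Nat.sub_add_cancel hnh]
    simp only [leadingCoeff]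
    ring

theorem exists_coeff_diamond_eq (f h : Polynomial ℝ) : ∃ c : ℝ, 0 < c ∧
    (diamond f h).coeff (f.natDegree + h.natDegree) = f.leadingCoeff * h.leadingCoeff * c := by
  refine ⟨_, ?_, coeff_diamond f h⟩
  refine Finset.sum_pos' (fun _ _ => by positivity) ⟨0, by simp, by simp⟩

theorem natDegree_diamond {f h : Polynomial ℝ} (hf : f ≠ 0) (hh : h ≠ 0) :
    (diamond f h).natDegree = f.natDegree + h.natDegree := by
  obtain ⟨c, hc, heq⟩ := exists_coeff_diamond_eq f h
  refine natDegree_eq_of_le_of_coeff_ne_zero (natDegree_diamond_le f h) ?_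
  rw [heq]
  exact mul_ne_zero (mul_ne_zero (leadingCoeff_ne_zero.mpr hf) (leadingCoeff_ne_zero.mpr hh)) hc.ne'

theorem exists_leadingCoeff_diamond_eq {f h : Polynomial ℝ} (hf : f ≠ 0) (hh : h ≠ 0) :
    ∃ c : ℝ, 0 < c ∧ (diamond f h).leadingCoeff = f.leadingCoeff * h.leadingCoeff * c := by
  rw [leadingCoeff, natDegree_diamond hf hh]
  exact exists_coeff_diamond_eq f h

theorem realRooted_iff_upperStable (f : Polynomial ℝ) :
    RealRooted f ↔ UpperStable (f.map (algebraMap ℝ ℂ)) := by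
  constructor
  · rintro ⟨-, hf⟩ z hz h0
    exact hz.ne' (hf z h0)
  · intro hf
    refine ⟨fun h => hf.ne_zero (by simp [h]), fun z hz => ?_⟩
    rcases lt_trichotomy z.im 0 with hlt | heq | hgt
    · refine absurd ?_ (hf (starRingEnd ℂ z) (by simpa using hlt))
      have : aeval (starRingEnd ℂ z) f = starRingEnd ℂ (aeval z f) := aeval_conj f z
      rw [eval_map_algebraMap, this, ← eval_map_algebraMap, hz.eq_zero, map_zero]
    · exact heq
    · exact absurd hz (hf z hgt)

theorem RealRooted.diamond {f h : Polynomial ℝ} (hf : RealRooted f) (hh0 : h ≠ 0)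
    (hh : ∀ z : ℂ, (h.map (algebraMap ℝ ℂ)).IsRoot z → z.im = 0 ∧ -1 ≤ z.re ∧ z.re ≤ 0) :
    RealRooted (diamond f h) := by
  rw [realRooted_iff_upperStable] at hf ⊢
  intro x hx
  rw [eval_map_diamond, ← natDegree_map (algebraMap ℝ ℂ) (p := h)]
  exact hf.sum_taylor_coeff_ne_zero
    ((Polynomial.map_ne_zero_iff (algebraMap ℝ ℂ).injective).mpr hh0) hh hx

/-- The Hermite–Biehler pencil of a pair is preserved by the diamond product. -/
theorem UpperStable.diamond_add {f g h : Polynomial ℝ} {a : ℂ}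
    (hfg : UpperStable (f.map (algebraMap ℝ ℂ) + C a * g.map (algebraMap ℝ ℂ))) (hh0 : h ≠ 0)
    (hh : ∀ z : ℂ, (h.map (algebraMap ℝ ℂ)).IsRoot z → z.im = 0 ∧ -1 ≤ z.re ∧ z.re ≤ 0) :
    UpperStable ((diamond f h).map (algebraMap ℝ ℂ) +
      C a * (diamond g h).map (algebraMap ℝ ℂ)) := by
  intro x hx
  have key := hfg.sum_taylor_coeff_ne_zero
    ((Polynomial.map_ne_zero_iff (algebraMap ℝ ℂ).injective).mpr hh0) hh hx
  rw [natDegree_map] at key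
  convert key using 1
  rw [eval_add, eval_mul, eval_C, eval_map_diamond, eval_map_diamond, Finset.mul_sum,
    ← Finset.sum_add_distrib]
  refine Finset.sum_congr rfl fun n _ => ?_
  rw [map_add, taylor_mul, taylor_C, coeff_add, coeff_C_mul]
  ring

/-- For `s > 0`, the argument in `(0, π)` of the complex number `a + s * I`. -/
noncomputable def upperAngle (a s : ℝ) : ℝ :=
  Real.pi / 2 - Real.arctan (a / s)

theorem upperAngle_pos (a s : ℝ) : 0 < upperAngle a s :=
  sub_pos.mpr (Real.arctan_lt_pi_div_two _)

theorem upperAngle_lt_pi (a s : ℝ) : upperAngle a s < Real.pi := by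
  have := Real.neg_pi_div_two_lt_arctan (a / s)
  unfold upperAngle
  linarith

theorem upperAngle_anti {a b s : ℝ} (hs : 0 < s) (hab : a ≤ b) :
    upperAngle b s ≤ upperAngle a s :=
  sub_le_sub_left (Real.arctan_strictMono.monotone (div_le_div_of_nonneg_right hab hs.le)) _

theorem continuousOn_upperAngle (a : ℝ) : ContinuousOn (upperAngle a) (Set.Ioi 0) := by
  refine continuousOn_const.sub (Real.continuous_arctan.comp_continuousOn ?_)
  exact continuousOn_const.div continuousOn_id fun s hs => (Set.mem_Ioi.mp hs).ne'

theorem tendsto_upperAngle_atTop (a : ℝ) :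
    Filter.Tendsto (upperAngle a) Filter.atTop (nhds (Real.pi / 2)) := by
  have h : Filter.Tendsto (fun s : ℝ => a / s) Filter.atTop (nhds 0) :=
    Filter.Tendsto.const_div_atTop Filter.tendsto_id a
  have := ((Real.continuous_arctan.tendsto 0).comp h).const_sub (Real.pi / 2)
  rwa [Real.arctan_zero, sub_zero] at this

theorem tendsto_upperAngle_zero {a : ℝ} (ha : a ≠ 0) :
    Filter.Tendsto (upperAngle a) (nhdsWithin 0 (Set.Ioi 0))
      (nhds (if a < 0 then Real.pi else 0)) := by
  rcases lt_or_gt_of_ne ha with hneg | hpos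
  · have h : Filter.Tendsto (fun s : ℝ => a / s) (nhdsWithin 0 (Set.Ioi 0)) Filter.atBot := by
      simpa [div_eq_mul_inv] using tendsto_inv_nhdsGT_zero.const_mul_atTop_of_neg hneg
    have := (tendsto_nhds_of_tendsto_nhdsWithin
      (Real.tendsto_arctan_atBot.comp h)).const_sub (Real.pi / 2)
    rw [sub_neg_eq_add, add_halves] at this
    rwa [if_pos hneg]
  · have h : Filter.Tendsto (fun s : ℝ => a / s) (nhdsWithin 0 (Set.Ioi 0)) Filter.atTop := by
      simpa [div_eq_mul_inv] using tendsto_inv_nhdsGT_zero.const_mul_atTop hpos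
    have := (tendsto_nhds_of_tendsto_nhdsWithin
      (Real.tendsto_arctan_atTop.comp h)).const_sub (Real.pi / 2)
    rw [sub_self] at this
    rwa [if_neg hpos.le.not_gt]

theorem exists_polar_upperAngle (a : ℝ) {s : ℝ} (hs : 0 < s) : ∃ r : ℝ, 0 < r ∧
    (a + s * Complex.I : ℂ) = r * Complex.exp (upperAngle a s * Complex.I) := by
  have hsq : 0 < Real.sqrt (1 + (a / s) ^ 2) := Real.sqrt_pos.mpr (by positivity)
  refine ⟨s * Real.sqrt (1 + (a / s) ^ 2), mul_pos hs hsq, ?_⟩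
  rw [Complex.exp_mul_I, ← Complex.ofReal_cos, ← Complex.ofReal_sin, upperAngle,
    Real.cos_pi_div_two_sub, Real.sin_pi_div_two_sub, Real.sin_arctan, Real.cos_arctan]
  apply Complex.ext
  · simp
    field_simp
  · simp
    field_simp

theorem RealRooted.splits {f : Polynomial ℝ} (hf : RealRooted f) : f.Splits := by
  refine Splits.of_splits_map (algebraMap ℝ ℂ) (IsAlgClosed.splits _) fun z hz => ?_
  exact ⟨z.re, Complex.ext (by simp) (by simpa using (hf.2 z (isRoot_of_mem_roots hz)).symm)⟩

theorem RealRooted.length_sortedRoots {f : Polynomial ℝ} (hf : RealRooted f) :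
    (sortedRoots f).length = f.natDegree := by
  rw [sortedRoots, Multiset.length_sort, hf.splits.natDegree_eq_card_roots]

theorem RealRooted.sortedRoots_getD_le {f : Polynomial ℝ} (hf : RealRooted f) {i j : ℕ}
    (hij : i ≤ j) (hj : j < f.natDegree) :
    (sortedRoots f).getD i 0 ≤ (sortedRoots f).getD j 0 := by
  rw [← hf.length_sortedRoots] at hj
  rw [List.getD_eq_getElem _ _ (hij.trans_lt hj), List.getD_eq_getElem _ _ hj]
  rcases hij.eq_or_lt with rfl | hlt
  · exact le_rfl
  · exact List.pairwise_iff_getElem.mp (Multiset.pairwise_sort f.roots (· ≤ ·)) i j _ hj hlt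

theorem List.prod_map_eq_prod_range_getD {M : Type*} [CommMonoid M] (l : List ℝ) (φ : ℝ → M) :
    (l.map φ).prod = ∏ i ∈ Finset.range l.length, φ (l.getD i 0) := by
  induction l with
  | nil => simp
  | cons a l ih => simp [Finset.prod_range_succ', ih, mul_comm]

theorem RealRooted.eval_map_eq_prod {f : Polynomial ℝ} (hf : RealRooted f) (x : ℂ) :
    (f.map (algebraMap ℝ ℂ)).eval x =
      f.leadingCoeff * ∏ i ∈ Finset.range f.natDegree, (x - (sortedRoots f).getD i 0) := by
  rw [← hf.length_sortedRoots, ← List.prod_map_eq_prod_range_getD (sortedRoots f)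
    (fun α => x - (α : ℂ)), (hf.splits.map (algebraMap ℝ ℂ)).eval_eq_prod_roots,
    hf.splits.roots_map_of_injective (algebraMap ℝ ℂ).injective, leadingCoeff_map,
    Multiset.map_map]
  conv_lhs => rw [← Multiset.sort_eq f.roots (· ≤ ·), Multiset.map_coe, Multiset.prod_coe]
  rfl

/-- The continuous argument of `f / f.leadingCoeff` at `t + s * I`: the sum of the arguments of
the linear factors. -/
noncomputable def rootAngle (f : Polynomial ℝ) (t s : ℝ) : ℝ :=
  ∑ i ∈ Finset.range f.natDegree, upperAngle (t - (sortedRoots f).getD i 0) s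

theorem RealRooted.exists_polar_eval {f : Polynomial ℝ} (hf : RealRooted f) (t : ℝ) {s : ℝ}
    (hs : 0 < s) : ∃ r : ℝ, 0 < r ∧ (f.map (algebraMap ℝ ℂ)).eval (t + s * Complex.I : ℂ) =
      f.leadingCoeff * (r * Complex.exp (rootAngle f t s * Complex.I)) := by
  choose r hr heq using fun i => exists_polar_upperAngle (t - (sortedRoots f).getD i 0) hs
  refine ⟨∏ i ∈ Finset.range f.natDegree, r i, Finset.prod_pos fun i _ => hr i, ?_⟩
  rw [hf.eval_map_eq_prod, rootAngle, Complex.ofReal_sum, Finset.sum_mul, Complex.exp_sum,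
    Complex.ofReal_prod, ← Finset.prod_mul_distrib]
  congr 1
  refine Finset.prod_congr rfl fun i _ => ?_
  rw [← heq]
  push_cast
  ring

theorem Interlaces.rootAngle_sub_mem {f g : Polynomial ℝ} (hgf : Interlaces g f) (t : ℝ) {s : ℝ}
    (hs : 0 < s) : rootAngle f t s - rootAngle g t s ∈ Set.Ioo 0 Real.pi := by
  obtain ⟨-, -, hdeg, hlt⟩ := hgf
  unfold rootAngle
  rw [hdeg]
  constructor
  · rw [Finset.sum_range_succ', sub_pos]
    refine lt_add_of_le_of_pos (Finset.sum_le_sum fun i hi => ?_) (upperAngle_pos _ _)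
    exact upperAngle_anti hs (sub_le_sub_left (hlt i (Finset.mem_range.mp hi)).2 _)
  · rw [Finset.sum_range_succ, sub_lt_iff_lt_add']
    refine add_lt_add_of_le_of_lt (Finset.sum_le_sum fun i hi => ?_) (upperAngle_lt_pi _ _)
    exact upperAngle_anti hs (sub_le_sub_left (hlt i (Finset.mem_range.mp hi)).1 _)

/-- Hermite–Biehler: an interlacing pair gives upper stable pencils `f + iμg`. -/
theorem Interlaces.upperStable_add {f g : Polynomial ℝ} (hgf : Interlaces g f) {μ : ℝ}
    (hμ : 0 < μ * (f.leadingCoeff * g.leadingCoeff)) :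
    UpperStable (f.map (algebraMap ℝ ℂ) + C (μ * Complex.I) * g.map (algebraMap ℝ ℂ)) := by
  intro x hx h0
  obtain ⟨r, hr, hfx⟩ := hgf.1.exists_polar_eval x.re hx
  obtain ⟨q, hq, hgx⟩ := hgf.2.1.exists_polar_eval x.re hx
  have hS := hgf.rootAngle_sub_mem x.re hx
  have hsin := Real.sin_pos_of_pos_of_lt_pi hS.1 hS.2
  rw [Complex.re_add_im] at hfx hgx
  set A := rootAngle f x.re x.im
  set B := rootAngle g x.re x.im
  rw [eval_add, eval_mul, eval_C, hfx, hgx] at h0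
  have hexp : Complex.exp (A * Complex.I) =
      Complex.exp (B * Complex.I) * Complex.exp ((A - B : ℝ) * Complex.I) := by
    rw [← Complex.exp_add]
    congr 1
    push_cast
    ring
  have hred : (f.leadingCoeff * r : ℂ) * Complex.exp ((A - B : ℝ) * Complex.I) +
      μ * g.leadingCoeff * q * Complex.I = 0 := by
    refine (mul_eq_zero.mp ?_).resolve_left (Complex.exp_ne_zero (B * Complex.I))
    rw [hexp] at h0
    linear_combination h0
  have him := congrArg Complex.im hred
  rw [Complex.exp_mul_I, ← Complex.ofReal_cos, ← Complex.ofReal_sin] at him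
  have him' : f.leadingCoeff * r * Real.sin (A - B) + μ * g.leadingCoeff * q = 0 := by
    simpa [-Complex.ofReal_cos, -Complex.ofReal_sin, -Complex.ofReal_sub] using him
  have hpos : 0 < f.leadingCoeff ^ 2 * (r * Real.sin (A - B)) :=
    mul_pos (sq_pos_of_ne_zero (leadingCoeff_ne_zero.mpr hgf.1.1)) (mul_pos hr hsin)
  have hpos' := mul_pos hμ hq
  have : f.leadingCoeff * (f.leadingCoeff * r * Real.sin (A - B) + μ * g.leadingCoeff * q) = 0 := by
    rw [him', mul_zero]
  nlinarith

/-- A pencil that is upper stable for all weights of the right sign keeps the relative argument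
of the pair away from `-π/2` modulo `2π`. -/
theorem rootAngle_sub_ne {f g : Polynomial ℝ} (hf : RealRooted f) (hg : RealRooted g)
    (hst : ∀ μ : ℝ, 0 < μ * (f.leadingCoeff * g.leadingCoeff) →
      UpperStable (f.map (algebraMap ℝ ℂ) + C (μ * Complex.I) * g.map (algebraMap ℝ ℂ)))
    (t : ℝ) {s : ℝ} (hs : 0 < s) {θ : ℝ}
    (hθ : Complex.exp (θ * Complex.I) = -Complex.I) :
    rootAngle f t s - rootAngle g t s ≠ θ := by
  intro hS
  obtain ⟨r, hr, hfx⟩ := hf.exists_polar_eval t hs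
  obtain ⟨q, hq, hgx⟩ := hg.exists_polar_eval t hs
  have hf0 := leadingCoeff_ne_zero.mpr hf.1
  have hg0 := leadingCoeff_ne_zero.mpr hg.1
  have hexp : Complex.exp (rootAngle f t s * Complex.I) =
      Complex.exp (rootAngle g t s * Complex.I) * -Complex.I := by
    rw [← hθ, ← Complex.exp_add, ← hS]
    congr 1
    push_cast
    ring
  refine hst (f.leadingCoeff * r / (g.leadingCoeff * q)) ?_ (t + s * Complex.I)
    (by simpa using hs) ?_
  · have : f.leadingCoeff * r / (g.leadingCoeff * q) * (f.leadingCoeff * g.leadingCoeff) =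
        f.leadingCoeff ^ 2 * (r / q) := by
      field_simp
    rw [this]
    positivity
  · rw [eval_add, eval_mul, eval_C, hfx, hgx, hexp]
    have hg0' : (g.leadingCoeff : ℂ) ≠ 0 := by exact_mod_cast hg0
    have hq' : (q : ℂ) ≠ 0 := by exact_mod_cast hq.ne'
    push_cast
    field_simp
    ring

theorem continuousOn_rootAngle (f : Polynomial ℝ) (t : ℝ) :
    ContinuousOn (rootAngle f t) (Set.Ioi 0) :=
  continuousOn_finsetSum _ fun _ _ => continuousOn_upperAngle _

theorem tendsto_rootAngle_atTop (f : Polynomial ℝ) (t : ℝ) :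
    Filter.Tendsto (rootAngle f t) Filter.atTop (nhds (f.natDegree * (Real.pi / 2))) := by
  have := tendsto_finsetSum (Finset.range f.natDegree) fun i _ =>
    tendsto_upperAngle_atTop (t - (sortedRoots f).getD i 0)
  rwa [Finset.sum_const, Finset.card_range, nsmul_eq_mul] at this

theorem RealRooted.tendsto_rootAngle_zero {f : Polynomial ℝ} (hf : RealRooted f) {t : ℝ}
    (ht : ¬f.IsRoot t) :
    Filter.Tendsto (rootAngle f t) (nhdsWithin 0 (Set.Ioi 0))
      (nhds (∑ i ∈ Finset.range f.natDegree,
        if t < (sortedRoots f).getD i 0 then Real.pi else 0)) := by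
  refine tendsto_finsetSum _ fun i hi => ?_
  have hlen : i < (sortedRoots f).length := by
    rw [hf.length_sortedRoots]
    exact Finset.mem_range.mp hi
  have hne : t - (sortedRoots f).getD i 0 ≠ 0 := by
    intro h
    refine ht ?_
    rw [sub_eq_zero.mp h, List.getD_eq_getElem _ _ hlen]
    exact isRoot_of_mem_roots ((Multiset.mem_sort (· ≤ ·)).mp (List.getElem_mem hlen))
  simpa [sub_neg] using tendsto_upperAngle_zero hne

theorem rootAngle_sub_mem_Icc {f g : Polynomial ℝ} (hf : RealRooted f) (hg : RealRooted g)
    (hdeg : f.natDegree = g.natDegree + 1)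
    (hst : ∀ μ : ℝ, 0 < μ * (f.leadingCoeff * g.leadingCoeff) →
      UpperStable (f.map (algebraMap ℝ ℂ) + C (μ * Complex.I) * g.map (algebraMap ℝ ℂ)))
    (t : ℝ) {s : ℝ} (hs : 0 < s) :
    rootAngle f t s - rootAngle g t s ∈ Set.Icc (-(Real.pi / 2)) (3 * Real.pi / 2) := by
  have hpi := Real.pi_pos
  set S : ℝ → ℝ := fun s => rootAngle f t s - rootAngle g t s
  have hcont : ContinuousOn S (Set.Ioi 0) :=
    (continuousOn_rootAngle f t).sub (continuousOn_rootAngle g t)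
  have hlim : Filter.Tendsto S Filter.atTop (nhds (Real.pi / 2)) := by
    convert (tendsto_rootAngle_atTop f t).sub (tendsto_rootAngle_atTop g t) using 2
    rw [hdeg]
    push_cast
    ring
  obtain ⟨M, hM, hM0⟩ := ((hlim.eventually (Ioo_mem_nhds (half_pos hpi) (half_lt_self hpi))).and
    (Filter.eventually_gt_atTop 0)).exists
  have hord := (isPreconnected_Ioi.image S hcont).ordConnected
  have hmem : ∀ {s : ℝ}, 0 < s → S s ∈ S '' Set.Ioi 0 := fun h => Set.mem_image_of_mem S h
  have hexp1 : Complex.exp ((-(Real.pi / 2) : ℝ) * Complex.I) = -Complex.I := by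
    rw [Complex.exp_mul_I, ← Complex.ofReal_cos, ← Complex.ofReal_sin]
    simp
  have hexp2 : Complex.exp ((3 * Real.pi / 2 : ℝ) * Complex.I) = -Complex.I := by
    rw [← hexp1, ← Complex.exp_periodic (((-(Real.pi / 2) : ℝ) : ℂ) * Complex.I)]
    congr 1
    push_cast
    ring
  constructor
  · by_contra! hlt
    obtain ⟨s', hs', heq⟩ := hord.out (hmem hs) (hmem hM0)
      ⟨hlt.le, (by linarith [hM.1] : -(Real.pi / 2) ≤ S M)⟩
    exact rootAngle_sub_ne hf hg hst t hs' hexp1 heq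
  · by_contra! hlt
    obtain ⟨s', hs', heq⟩ := hord.out (hmem hM0) (hmem hs)
      ⟨(by linarith [hM.2] : S M ≤ 3 * Real.pi / 2), hlt.le⟩
    exact rootAngle_sub_ne hf hg hst t hs' hexp2 heq

theorem sum_range_ite_le (n i : ℕ) (c : ℝ) :
    ∑ j ∈ Finset.range n, (if i ≤ j then c else 0) = ((n - i : ℕ) : ℝ) * c := by
  induction n with
  | zero => simp
  | succ n ih =>
    rw [Finset.sum_range_succ, ih]
    split_ifs with h
    · rw [Nat.succ_sub h]
      push_cast
      ring
    · rw [Nat.sub_eq_zero_of_le (by omega : n + 1 ≤ i), Nat.sub_eq_zero_of_le (by omega : n ≤ i)]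
      simp

theorem exists_mem_Ioo_not_isRoot {p : Polynomial ℝ} (hp : p ≠ 0) {a b : ℝ} (hab : a < b) :
    ∃ t ∈ Set.Ioo a b, ¬p.IsRoot t :=
  ((Set.Ioo_infinite hab).exists_notMem_finite (finite_setOfPred_isRoot hp))

/-- The converse Hermite–Biehler theorem. -/
theorem interlaces_of_upperStable_add {f g : Polynomial ℝ} (hf : RealRooted f)
    (hg : RealRooted g) (hdeg : f.natDegree = g.natDegree + 1)
    (hst : ∀ μ : ℝ, 0 < μ * (f.leadingCoeff * g.leadingCoeff) →
      UpperStable (f.map (algebraMap ℝ ℂ) + C (μ * Complex.I) * g.map (algebraMap ℝ ℂ))) :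
    Interlaces g f := by
  have hpi := Real.pi_pos
  have hcount : ∀ t : ℝ, ¬(f * g).IsRoot t →
      (∑ i ∈ Finset.range f.natDegree, if t < (sortedRoots f).getD i 0 then Real.pi else 0) -
        (∑ i ∈ Finset.range g.natDegree, if t < (sortedRoots g).getD i 0 then Real.pi else 0) ∈
      Set.Icc (-(Real.pi / 2)) (3 * Real.pi / 2) := by
    intro t ht
    rw [root_mul, not_or] at ht
    refine isClosed_Icc.mem_of_tendsto
      ((hf.tendsto_rootAngle_zero ht.1).sub (hg.tendsto_rootAngle_zero ht.2)) ?_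
    filter_upwards [self_mem_nhdsWithin] with s hs
    exact rootAngle_sub_mem_Icc hf hg hdeg hst t hs
  refine ⟨hf, hg, hdeg, fun i hi => ⟨?_, ?_⟩⟩
  · by_contra! hlt
    obtain ⟨t, ⟨htg, htf⟩, ht⟩ := exists_mem_Ioo_not_isRoot (mul_ne_zero hf.1 hg.1) hlt
    have hF : ∑ j ∈ Finset.range f.natDegree, (if i ≤ j then Real.pi else 0) ≤
        ∑ j ∈ Finset.range f.natDegree,
          if t < (sortedRoots f).getD j 0 then Real.pi else 0 := by
      refine Finset.sum_le_sum fun j hj => ?_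
      by_cases hij : i ≤ j
      · rw [if_pos hij,
          if_pos (htf.trans_le (hf.sortedRoots_getD_le hij (Finset.mem_range.mp hj)))]
      · rw [if_neg hij]
        positivity
    have hG : ∑ j ∈ Finset.range g.natDegree,
          (if t < (sortedRoots g).getD j 0 then Real.pi else 0) ≤
        ∑ j ∈ Finset.range g.natDegree, if i + 1 ≤ j then Real.pi else 0 := by
      refine Finset.sum_le_sum fun j hj => ?_
      by_cases hij : i + 1 ≤ j
      · rw [if_pos hij]
        split_ifs <;> linarith
      · rw [if_neg hij,
          if_neg (((hg.sortedRoots_getD_le (by omega : j ≤ i) hi).trans_lt htg).le.not_gt)]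
    rw [sum_range_ite_le] at hF hG
    have hcast : ((f.natDegree - i : ℕ) : ℝ) = ((g.natDegree - (i + 1) : ℕ) : ℝ) + 2 := by
      have : f.natDegree - i = g.natDegree - (i + 1) + 2 := by omega
      exact_mod_cast this
    rw [hcast] at hF
    linarith [(hcount t ht).2]
  · by_contra! hlt
    obtain ⟨t, ⟨htf, htg⟩, ht⟩ := exists_mem_Ioo_not_isRoot (mul_ne_zero hf.1 hg.1) hlt
    have hF : ∑ j ∈ Finset.range f.natDegree,
          (if t < (sortedRoots f).getD j 0 then Real.pi else 0) ≤
        ∑ j ∈ Finset.range f.natDegree, if i + 2 ≤ j then Real.pi else 0 := by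
      refine Finset.sum_le_sum fun j hj => ?_
      by_cases hij : i + 2 ≤ j
      · rw [if_pos hij]
        split_ifs <;> linarith
      · rw [if_neg hij, if_neg (((hf.sortedRoots_getD_le (by omega : j ≤ i + 1)
          (by omega)).trans_lt htf).le.not_gt)]
    have hG : ∑ j ∈ Finset.range g.natDegree, (if i ≤ j then Real.pi else 0) ≤
        ∑ j ∈ Finset.range g.natDegree,
          if t < (sortedRoots g).getD j 0 then Real.pi else 0 := by
      refine Finset.sum_le_sum fun j hj => ?_
      by_cases hij : i ≤ j
      · rw [if_pos hij,
          if_pos (htg.trans_le (hg.sortedRoots_getD_le hij (Finset.mem_range.mp hj)))]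
      · rw [if_neg hij]
        positivity
    rw [sum_range_ite_le] at hF hG
    have hcast : ((g.natDegree - i : ℕ) : ℝ) = ((f.natDegree - (i + 2) : ℕ) : ℝ) + 1 := by
      have : g.natDegree - i = f.natDegree - (i + 2) + 1 := by omega
      exact_mod_cast this
    rw [hcast] at hG
    linarith [(hcount t ht).1]

/-- **Theorem 2.12 (a).** If `h` is nonzero with all complex zeros in `[-1,0]` and `f` is
real-rooted, then `f ◇ h` is real-rooted or zero, and `g ⪯ f` implies `g ◇ h ⪯ f ◇ h`. -/
theorem diamond_real_rooted_and_interlaces (h f : Polynomial ℝ)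
    (hh0 : h ≠ 0)
    (hh : ∀ z : ℂ, (h.map (algebraMap ℝ ℂ)).IsRoot z → z.im = 0 ∧ -1 ≤ z.re ∧ z.re ≤ 0)
    (hf : RealRooted f) :
    (diamond f h = 0 ∨ RealRooted (diamond f h)) ∧
    (∀ g : Polynomial ℝ, RealRooted g → Interlaces g f →
      Interlaces (diamond g h) (diamond f h)) := by
  refine ⟨Or.inr (hf.diamond hh0 hh), fun g hg hgf => ?_⟩
  refine interlaces_of_upperStable_add (hf.diamond hh0 hh) (hg.diamond hh0 hh) ?_ fun μ hμ => ?_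
  · rw [natDegree_diamond hf.1 hh0, natDegree_diamond hg.1 hh0, hgf.2.2.1]
    ring
  · refine UpperStable.diamond_add (hgf.upperStable_add ?_) hh0 hh
    obtain ⟨a, ha, hfa⟩ := exists_leadingCoeff_diamond_eq hf.1 hh0
    obtain ⟨b, hb, hgb⟩ := exists_leadingCoeff_diamond_eq hg.1 hh0
    have hpos : 0 < h.leadingCoeff ^ 2 * (a * b) := by
      have := leadingCoeff_ne_zero.mpr hh0
      positivity
    refine pos_of_mul_pos_left ?_ hpos.le
    rw [hfa, hgb] at hμ
    linarith
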